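/- arXiv:1503.00745 — 2 statements merged into one kernel-verified Lean document; each statement's English description precedes it below -/
import Mathlib

section
/- Let (X,≤) be a well quasi order and S ⊆ X. Then every maximal ideal of ↓S is in the adherence of S. -/
/-- `D` is downward-closed for the quasi-order `le`. -/
def DownClosed {X : Type*} (le : X → X → Prop) (D : Set X) : Prop :=
  ∀ ⦃x y : X⦄, le x y → y ∈ D → x ∈ D

/-- `U` is upward-closed for the quasi-order `le`. -/
def UpClosed {X : Type*} (le : X → X → Prop) (U : Set X) : Prop :=
  ∀ ⦃x y : X⦄, le x y → x ∈ U → y ∈ U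

/-- `S` is directed for the quasi-order `le`. -/
def DirectedSet {X : Type*} (le : X → X → Prop) (S : Set X) : Prop :=
  ∀ x₁ ∈ S, ∀ x₂ ∈ S, ∃ x ∈ S, le x₁ x ∧ le x₂ x

/-- An ideal: a nonempty, downward-closed, directed subset. -/
def IsIdealSet {X : Type*} (le : X → X → Prop) (I : Set X) : Prop :=
  I.Nonempty ∧ DownClosed le I ∧ DirectedSet le I

/-- Downward closure `↓S`. -/
def DownCl {X : Type*} (le : X → X → Prop) (S : Set X) : Set X :=
  {x | ∃ s ∈ S, le x s}

/-- Upward closure `↑S`. -/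
def UpCl {X : Type*} (le : X → X → Prop) (S : Set X) : Set X :=
  {x | ∃ s ∈ S, le s x}

/-- A well quasi order: a reflexive transitive relation such that every infinite
sequence is good (some `f i ≤ f j` with `i < j`). -/
def IsWqo {X : Type*} (le : X → X → Prop) : Prop :=
  Reflexive le ∧ Transitive le ∧ ∀ f : ℕ → X, ∃ i j : ℕ, i < j ∧ le (f i) (f j)

/-- Downward-closed sets of a wqo satisfy the descending chain condition. -/
theorem IsWqo.wellFounded_downClosed {X : Type*} {le : X → X → Prop} (hwqo : IsWqo le) :
    WellFounded fun A B : {D : Set X // DownClosed le D} => A.1 ⊂ B.1 := by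
  rw [wellFounded_iff_isEmpty_descending_chain]
  refine ⟨fun ⟨f, hf⟩ => ?_⟩
  choose x hx hx' using fun n => Set.exists_of_ssubset (hf n)
  obtain ⟨i, j, hij, hle⟩ := hwqo.2.2 x
  have hanti : Antitone fun n => (f n).1 := antitone_nat_of_succ_le fun n => (hf n).1
  exact hx' i ((f (i + 1)).2 hle (hanti (Nat.succ_le_of_lt hij) (hx j)))

/-- Removing from a downward-closed set the elements above a given one leaves it
downward-closed. -/
theorem DownClosed.sep_not_le {X : Type*} {le : X → X → Prop} (htrans : Transitive le)
    {D : Set X} (hD : DownClosed le D) (a : X) : DownClosed le {d ∈ D | ¬ le a d} :=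
  fun _ _ hxy hy => ⟨hD hxy hy.1, fun h => hy.2 (htrans h hxy)⟩

/-- A directed set contained in a union of two downward-closed sets is contained in one of them. -/
theorem DirectedSet.subset_or_subset {X : Type*} {le : X → X → Prop} {I A B : Set X}
    (hI : DirectedSet le I) (hA : DownClosed le A) (hB : DownClosed le B) (h : I ⊆ A ∪ B) :
    I ⊆ A ∨ I ⊆ B := by
  by_contra! hcon
  obtain ⟨u, hu, huA⟩ := Set.not_subset.1 hcon.1
  obtain ⟨v, hv, hvB⟩ := Set.not_subset.1 hcon.2
  obtain ⟨w, hw, huw, hvw⟩ := hI u hu v hv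
  exact (h hw).elim (fun hwA => huA (hA huw hwA)) fun hwB => hvB (hB hvw hwB)

/-- If no ideal inside a downward-closed set `D` strictly contains the ideal `I`, then `D` is
covered by `I` and a downward-closed set that does not contain `I`. -/
theorem IsWqo.exists_downClosed_cover {X : Type*} {le : X → X → Prop} (hwqo : IsWqo le)
    {I : Set X} (hI : IsIdealSet le I) (D : {D : Set X // DownClosed le D})
    (hmax : ∀ J : Set X, IsIdealSet le J → J ⊆ D.1 → I ⊆ J → J = I) :
    ∃ E : Set X, DownClosed le E ∧ ¬ I ⊆ E ∧ D.1 ⊆ I ∪ E := by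
  induction D using hwqo.wellFounded_downClosed.induction with
  | _ D ih =>
  by_cases hID : I ⊆ D.1
  · by_cases hdir : DirectedSet le D.1
    · have hDI := hmax D.1 ⟨hI.1.mono hID, D.2, hdir⟩ subset_rfl hID
      refine ⟨∅, fun _ _ _ h => h.elim, fun h => ?_, fun d hd => Or.inl (hDI ▸ hd)⟩
      obtain ⟨a, ha⟩ := hI.1
      exact h ha
    · simp only [DirectedSet] at hdir
      push Not at hdir
      obtain ⟨a, ha, b, hb, hab⟩ := hdir
      have cover : ∀ c ∈ D.1, ∃ E : Set X, DownClosed le E ∧ ¬ I ⊆ E ∧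
          {d ∈ D.1 | ¬ le c d} ⊆ I ∪ E := fun c hc =>
        ih ⟨{d ∈ D.1 | ¬ le c d}, D.2.sep_not_le hwqo.2.1 c⟩
          ⟨Set.sep_subset _ _, fun h => (h hc).2 (hwqo.1 c)⟩
          fun J hJ hJD => hmax J hJ (hJD.trans (Set.sep_subset _ _))
      obtain ⟨E, hE, hIE, hcE⟩ := cover a ha
      obtain ⟨F, hF, hIF, hcF⟩ := cover b hb
      refine ⟨E ∪ F, fun _ _ hxy => Or.imp (hE hxy) (hF hxy),
        fun h => (hI.2.2.subset_or_subset hE hF h).elim hIE hIF, fun d hd => ?_⟩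
      by_cases had : le a d
      · exact (hcF ⟨hd, hab d hd had⟩).imp_right Or.inr
      · exact (hcE ⟨hd, had⟩).imp_right Or.inl
  · exact ⟨D.1, D.2, hID, Set.subset_union_right⟩

/-- In a wqo, every maximal ideal of `↓S` is in the adherence of `S`: it is the
downward closure of some directed subset of `S`. -/
theorem maximal_ideal_adherent {X : Type*} (le : X → X → Prop)
    (hwqo : IsWqo le) (S : Set X) (I : Set X)
    (hI : IsIdealSet le I) (hsub : I ⊆ DownCl le S)
    (hmax : ∀ J : Set X, IsIdealSet le J → J ⊆ DownCl le S → I ⊆ J → J = I) :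
    ∃ Δ : Set X, Δ ⊆ S ∧ DirectedSet le Δ ∧ DownCl le Δ = I := by
  have hrefl := hwqo.1
  have htrans := hwqo.2.1
  obtain ⟨E, hE, hIE, hcover⟩ := hwqo.exists_downClosed_cover hI
    ⟨DownCl le S, fun _ _ hxy ⟨s, hs, hys⟩ => ⟨s, hs, htrans hxy hys⟩⟩ hmax
  obtain ⟨y, hy, hyE⟩ := Set.not_subset.1 hIE
  have key : ∀ x ∈ I, ∃ s ∈ S ∩ I, le x s := by
    intro x hx
    obtain ⟨z, hz, hxz, hyz⟩ := hI.2.2 x hx y hy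
    obtain ⟨s, hs, hzs⟩ := hsub hz
    have hsI : s ∈ I := (hcover ⟨s, hs, hrefl s⟩).resolve_right
      fun hsE => hyE (hE (htrans hyz hzs) hsE)
    exact ⟨s, ⟨hs, hsI⟩, htrans hxz hzs⟩
  refine ⟨S ∩ I, Set.inter_subset_left, ?_, Set.Subset.antisymm ?_ key⟩
  · intro s hs t ht
    obtain ⟨z, hz, hsz, htz⟩ := hI.2.2 s hs.2 t ht.2
    obtain ⟨r, hr, hzr⟩ := key z hz
    exact ⟨r, hr, htrans hsz hzr, htrans htz hzr⟩
  · rintro x ⟨s, hs, hxs⟩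
    exact hI.2.1 hxs hs.2
end

section
/- Let γ = (c,P) with c ∈ ℕ^d and P ⊆ ℕ^d × ℕ^d a periodic set included in ↝_c. Then the graph G_γ = (S_γ, E_γ, s_γ) is strongly connected, the triple M_γ = (s_γ^in, G_γ, s_γ^out) is a marked witness graph, and Ω_γ ⊆ Ω_{M_γ}. -/
/-- Configurations of a `d`-dimensional VAS: vectors in `ℕ^d`. -/
abbrev Conf (d : ℕ) := Fin d → ℕ

/-- Actions: vectors in `ℤ^d`. -/
abbrev Act (d : ℕ) := Fin d → ℤ

/-- Triples in `ℕ^d × ℤ^d × ℕ^d` (potential transitions). -/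
abbrev Trip (d : ℕ) := Conf d × Act d × Conf d

/-- Preruns: a source, a word of triples, and a target. -/
abbrev PreRun (d : ℕ) := Conf d × List (Trip d) × Conf d

/-- A transition of the VAS `A`: a triple `(u, a, v)` with `a ∈ A` and
`v = u + a`. -/
def IsTransition {d : ℕ} (A : Set (Act d)) (t : Trip d) : Prop :=
  t.2.1 ∈ A ∧ ∀ i, (t.2.2 i : ℤ) = (t.1 i : ℤ) + t.2.1 i

/-- `ChainFrom x w y` holds when the word `w` of triples chains from `x` to
`y`: either `w` is empty and `x = y`, or the first source is `x`, the last
target is `y`, and the target of each triple is the source of the next one. -/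
def ChainFrom {d : ℕ} : Conf d → List (Trip d) → Conf d → Prop
  | x, [], y => x = y
  | x, t :: w, y => t.1 = x ∧ ChainFrom t.2.2 w y

/-- A run of the VAS `A`: a prerun whose triples are transitions of `A`
chaining from its source to its target. -/
def IsRun {d : ℕ} (A : Set (Act d)) (ρ : PreRun d) : Prop :=
  (∀ t ∈ ρ.2.1, IsTransition A t) ∧ ChainFrom ρ.1 ρ.2.1 ρ.2.2

/-- A subset `P` of `ℕ^d × ℕ^d` is periodic if it contains the zero vector and
is closed under componentwise addition. -/
def PeriodicPairs {d : ℕ} (P : Set (Conf d × Conf d)) : Prop :=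
  (0, 0) ∈ P ∧ ∀ p ∈ P, ∀ q ∈ P, p + q ∈ P

/-- The transformer relation with capacity `c`: `u ↝_c v` iff there is a run
from `u + c` to `v + c`. -/
def Transformer {d : ℕ} (A : Set (Act d)) (c : Conf d) (u v : Conf d) : Prop :=
  ∃ w : List (Trip d), IsRun A (u + c, w, v + c)

/-- Membership in `Ω_γ` for `γ = (c, P)`: the runs from `c + u` to `c + v`
with `(u, v) ∈ P`. -/
def InOmega {d : ℕ} (A : Set (Act d)) (c : Conf d) (P : Set (Conf d × Conf d))
    (ρ : PreRun d) : Prop :=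
  IsRun A ρ ∧ ∃ p ∈ P, ρ.1 = c + p.1 ∧ ρ.2.2 = c + p.2

/-- The configuration `q` occurs along the prerun `ρ`. -/
def OccursIn {d : ℕ} (q : Conf d) (ρ : PreRun d) : Prop :=
  q = ρ.1 ∨ q = ρ.2.2 ∨ ∃ t ∈ ρ.2.1, q = t.1 ∨ q = t.2.2

/-- `Q_γ`: the set of configurations occurring along runs of `Ω_γ`. -/
def Qgamma {d : ℕ} (A : Set (Act d)) (c : Conf d)
    (P : Set (Conf d × Conf d)) : Set (Conf d) :=
  {q : Conf d | ∃ ρ : PreRun d, InOmega A c P ρ ∧ OccursIn q ρ}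

/-- `F_γ`: the set of indices on which `Q_γ` is bounded, i.e. such that
`{q i | q ∈ Q_γ}` is finite. -/
def Fgamma {d : ℕ} (A : Set (Act d)) (c : Conf d)
    (P : Set (Conf d × Conf d)) : Set (Fin d) :=
  {i : Fin d | ((fun q : Conf d => q i) '' Qgamma A c P).Finite}

/-- Partial configurations: vectors in `ℕ_ω^d 
  (`ℕ_ω = ℕ ∪ {ω}`, represented by `ℕ∞`, with `ω = ⊤`). -/
abbrev PConf (d : ℕ) := Fin d → ℕ∞

/-- Embedding of configurations into partial configurations. -/
def toPC {d : ℕ} (q : Conf d) : PConf d := fun i => (q i : ℕ∞)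

open scoped Classical in
/-- The projection `π_F`: keeps the coordinates in `F` and sets the others
to `ω`. -/
noncomputable def projPC {d : ℕ} (F : Set (Fin d)) (u : PConf d) : PConf d :=
  fun i => if i ∈ F then u i else ⊤

/-- The finite (defined) coordinates of a partial configuration. -/
def FinCoords {d : ℕ} (u : PConf d) : Set (Fin d) := {i | u i ≠ ⊤}

/-- A partial transition: a triple `(u, a, v)` in `ℕ_ω^d × A × ℕ_ω^d` with
`v = u + a`, where `ω + k = ω`. -/
def IsPartialTransition {d : ℕ} (A : Set (Act d))
    (e : PConf d × Act d × PConf d) : Prop :=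
  e.2.1 ∈ A ∧ ∀ i,
    (e.1 i = ⊤ ∧ e.2.2 i = ⊤) ∨
    ∃ m n : ℕ, e.1 i = (m : ℕ∞) ∧ e.2.2 i = (n : ℕ∞) ∧
      (n : ℤ) = (m : ℤ) + e.2.1 i

/-- Paths in a labelled graph with edge set `E`: `PathIn E p σ q` holds iff
there is a path from `p` to `q` whose sequence of action labels is `σ`. -/
inductive PathIn {d : ℕ} (E : Set (PConf d × Act d × PConf d)) :
    PConf d → List (Act d) → PConf d → Prop
  | nil (p : PConf d) : PathIn E p [] p
  | cons {p q r : PConf d} {a : Act d} {σ : List (Act d)} :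
      (p, a, q) ∈ E → PathIn E q σ r → PathIn E p (a :: σ) r

/-- A witness graph `(S, E, s)` for the VAS `A`: a nonempty finite set `S` of
partial configurations with common set `F` of finite coordinates, a finite set
`E ⊆ S × A × S` of partial transitions, a distinguished state `s ∈ S`, the
graph being strongly connected. -/
def IsWitnessGraph {d : ℕ} (A : Set (Act d)) (F : Set (Fin d))
    (S : Set (PConf d)) (E : Set (PConf d × Act d × PConf d))
    (s : PConf d) : Prop :=
  S.Nonempty ∧ S.Finite ∧ (∀ p ∈ S, FinCoords p = F) ∧
  E.Finite ∧ (∀ e ∈ E, e.1 ∈ S ∧ e.2.2 ∈ S ∧ IsPartialTransition A e) ∧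
  s ∈ S ∧ ∀ p ∈ S, ∀ q ∈ S, ∃ σ : List (Act d), PathIn E p σ q

/-- A marked witness graph `(s^in, (S,E,s), s^out)`: a witness graph together
with partial configurations `s^in, s^out` whose sets `F^in, F^out` of finite
coordinates contain `F`, and with `π_F s^in = π_F s^out = s`. -/
def IsMarkedWitnessGraph {d : ℕ} (A : Set (Act d))
    (F Fin' Fout : Set (Fin d)) (S : Set (PConf d))
    (E : Set (PConf d × Act d × PConf d)) (s sin sout : PConf d) : Prop :=
  IsWitnessGraph A F S E s ∧ F ⊆ Fin' ∧ F ⊆ Fout ∧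
  FinCoords sin = Fin' ∧ FinCoords sout = Fout ∧
  projPC F sin = s ∧ projPC F sout = s

/-- The label of a prerun: its sequence of actions. -/
def labelOf {d : ℕ} (ρ : PreRun d) : List (Act d) := ρ.2.1.map (fun t => t.2.1)

/-- Membership in `Ω_M` for a marked witness graph
`M = (s^in, (S,E,s), s^out)`: the runs `x →σ y` such that `σ` labels a cycle
on `s` in the graph, `π_{F^in} x = s^in` and `π_{F^out} y = s^out`. -/
def InOmegaM {d : ℕ} (A : Set (Act d)) (Fin' Fout : Set (Fin d))
    (E : Set (PConf d × Act d × PConf d)) (s sin sout : PConf d)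
    (ρ : PreRun d) : Prop :=
  IsRun A ρ ∧ PathIn E s (labelOf ρ) s ∧
  projPC Fin' (toPC ρ.1) = sin ∧ projPC Fout (toPC ρ.2.2) = sout

/-- `F_γ^in`: the indices `i` with `u i = 0` for every `(u,v) ∈ P`. -/
def FinGamma {d : ℕ} (P : Set (Conf d × Conf d)) : Set (Fin d) :=
  {i : Fin d | ∀ p ∈ P, p.1 i = 0}

/-- `F_γ^out`: the indices `i` with `v i = 0` for every `(u,v) ∈ P`. -/
def FoutGamma {d : ℕ} (P : Set (Conf d × Conf d)) : Set (Fin d) :=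
  {i : Fin d | ∀ p ∈ P, p.2 i = 0}

/-- `s_γ = π_{F_γ}(c)`. -/
noncomputable def sgamma {d : ℕ} (A : Set (Act d)) (c : Conf d)
    (P : Set (Conf d × Conf d)) : PConf d :=
  projPC (Fgamma A c P) (toPC c)

/-- `S_γ = π_{F_γ}(Q_γ)`. -/
noncomputable def Sgamma {d : ℕ} (A : Set (Act d)) (c : Conf d)
    (P : Set (Conf d × Conf d)) : Set (PConf d) :=
  (fun q : Conf d => projPC (Fgamma A c P) (toPC q)) '' Qgamma A c P

/-- `E_γ`: the partial transitions `(π_{F_γ} q, a, π_{F_γ} q')` for transitions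
`(q, a, q')` occurring along runs of `Ω_γ`. -/
noncomputable def Egamma {d : ℕ} (A : Set (Act d)) (c : Conf d)
    (P : Set (Conf d × Conf d)) : Set (PConf d × Act d × PConf d) :=
  {e : PConf d × Act d × PConf d | ∃ t : Trip d,
    (∃ ρ : PreRun d, InOmega A c P ρ ∧ t ∈ ρ.2.1) ∧
    e = (projPC (Fgamma A c P) (toPC t.1), t.2.1,
         projPC (Fgamma A c P) (toPC t.2.2))}

/-- `s_γ^in = π_{F_γ^in}(c)`. -/
noncomputable def sinGamma {d : ℕ} (c : Conf d)
    (P : Set (Conf d × Conf d)) : PConf d :=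
  projPC (FinGamma P) (toPC c)

/-- `s_γ^out = π_{F_γ^out}(c)`. -/
noncomputable def soutGamma {d : ℕ} (c : Conf d)
    (P : Set (Conf d × Conf d)) : PConf d :=
  projPC (FoutGamma P) (toPC c)

theorem PathIn.append {d : ℕ} {E : Set (PConf d × Act d × PConf d)} {p q r : PConf d}
    {σ τ : List (Act d)} (h : PathIn E p σ q) (h' : PathIn E q τ r) :
    PathIn E p (σ ++ τ) r := by
  induction h with
  | nil => exact h'
  | cons he _ ih => exact .cons he (ih h')

theorem ChainFrom.pathIn {d : ℕ} {E : Set (PConf d × Act d × PConf d)} (f : Conf d → PConf d)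
    {w : List (Trip d)} {x y : Conf d} (hw : ChainFrom x w y)
    (hE : ∀ t ∈ w, (f t.1, t.2.1, f t.2.2) ∈ E) :
    PathIn E (f x) (w.map fun t => t.2.1) (f y) := by
  induction w generalizing x with
  | nil => obtain rfl : x = y := hw; exact .nil _
  | cons t w ih =>
    obtain ⟨rfl, hw⟩ := hw
    exact .cons (hE t (by simp)) (ih hw fun s hs => hE s (by simp [hs]))

/-- A configuration occurring along a chain splits the image of the chain into two paths. -/
theorem ChainFrom.exists_pathIn_of_occursIn {d : ℕ} {E : Set (PConf d × Act d × PConf d)}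
    (f : Conf d → PConf d) {w : List (Trip d)} {x y q : Conf d} (hw : ChainFrom x w y)
    (hE : ∀ t ∈ w, (f t.1, t.2.1, f t.2.2) ∈ E) (hq : OccursIn q (x, w, y)) :
    (∃ σ, PathIn E (f x) σ (f q)) ∧ ∃ τ, PathIn E (f q) τ (f y) := by
  induction w generalizing x with
  | nil =>
    obtain rfl : x = y := hw
    obtain rfl : q = x := by simpa [OccursIn] using hq
    exact ⟨⟨_, .nil _⟩, ⟨_, .nil _⟩⟩
  | cons t w ih =>
    have hpath := hw.pathIn f hE
    obtain ⟨rfl, hw⟩ := hw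
    by_cases h : q = t.1
    · subst h
      exact ⟨⟨_, .nil _⟩, ⟨_, hpath⟩⟩
    · have hq' : OccursIn q (t.2.2, w, y) := by
        simp only [OccursIn, List.mem_cons] at hq ⊢
        grind
      obtain ⟨⟨σ, hσ⟩, hτ⟩ := ih hw (fun s hs => hE s (by simp [hs])) hq'
      exact ⟨⟨_, .cons (hE t (by simp)) hσ⟩, hτ⟩

theorem finCoords_projPC_toPC {d : ℕ} (F : Set (Fin d)) (q : Conf d) :
    FinCoords (projPC F (toPC q)) = F := by
  ext i
  simp [FinCoords, projPC, toPC]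

theorem projPC_projPC_of_subset {d : ℕ} {F G : Set (Fin d)} (h : F ⊆ G) (u : PConf d) :
    projPC F (projPC G u) = projPC F u := by
  funext i
  by_cases hi : i ∈ F
  · simp [projPC, hi, h hi]
  · simp [projPC, hi]

theorem projPC_toPC_add {d : ℕ} {F : Set (Fin d)} (c : Conf d) {u : Conf d}
    (h : ∀ i ∈ F, u i = 0) : projPC F (toPC (c + u)) = projPC F (toPC c) := by
  funext i
  by_cases hi : i ∈ F
  · simp [projPC, toPC, hi, h i hi]
  · simp [projPC, hi]

theorem PeriodicPairs.nsmul_mem {d : ℕ} {P : Set (Conf d × Conf d)} (h : PeriodicPairs P)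
    {p : Conf d × Conf d} (hp : p ∈ P) (n : ℕ) : n • p ∈ P := by
  induction n with
  | zero => rw [zero_nsmul]; exact h.1
  | succ n ih => rw [succ_nsmul]; exact h.2 _ ih _ hp

theorem exists_inOmega {d : ℕ} {A : Set (Act d)} {c : Conf d} {P : Set (Conf d × Conf d)}
    (hPc : ∀ p ∈ P, Transformer A c p.1 p.2) {p : Conf d × Conf d} (hp : p ∈ P) :
    ∃ w, InOmega A c P (c + p.1, w, c + p.2) := by
  obtain ⟨w, hw⟩ := hPc p hp
  rw [add_comm p.1, add_comm p.2] at hw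
  exact ⟨w, hw, p, hp, rfl, rfl⟩

theorem add_mem_Qgamma {d : ℕ} {A : Set (Act d)} {c : Conf d} {P : Set (Conf d × Conf d)}
    (hPc : ∀ p ∈ P, Transformer A c p.1 p.2) {p : Conf d × Conf d} (hp : p ∈ P) :
    c + p.1 ∈ Qgamma A c P ∧ c + p.2 ∈ Qgamma A c P := by
  obtain ⟨w, hw⟩ := exists_inOmega hPc hp
  exact ⟨⟨_, hw, .inl rfl⟩, ⟨_, hw, .inr (.inl rfl)⟩⟩

theorem eq_zero_of_forall_nsmul_mem {d : ℕ} {Q : Set (Conf d)} {c u : Conf d} {i : Fin d}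
    (hQ : ((fun q : Conf d => q i) '' Q).Finite) (h : ∀ n : ℕ, c + n • u ∈ Q) : u i = 0 := by
  obtain ⟨B, hB⟩ := hQ.bddAbove
  by_contra hu
  have hle : c i + (B + 1) * u i ≤ B := by simpa using hB ⟨_, h (B + 1), rfl⟩
  nlinarith [Nat.pos_of_ne_zero hu]

theorem Fgamma_subset {d : ℕ} {A : Set (Act d)} {c : Conf d} {P : Set (Conf d × Conf d)}
    (hper : PeriodicPairs P) (hPc : ∀ p ∈ P, Transformer A c p.1 p.2) :
    Fgamma A c P ⊆ FinGamma P ∧ Fgamma A c P ⊆ FoutGamma P :=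
  ⟨fun _ hi _ hp => eq_zero_of_forall_nsmul_mem hi fun n =>
      (add_mem_Qgamma hPc (hper.nsmul_mem hp n)).1,
    fun _ hi _ hp => eq_zero_of_forall_nsmul_mem hi fun n =>
      (add_mem_Qgamma hPc (hper.nsmul_mem hp n)).2⟩

theorem Sgamma_finite {d : ℕ} (A : Set (Act d)) (c : Conf d) (P : Set (Conf d × Conf d)) :
    (Sgamma A c P).Finite := by
  have hfin : ∀ i, ((fun p : PConf d => p i) '' Sgamma A c P).Finite := by
    intro i
    by_cases hi : i ∈ Fgamma A c P
    · refine (Set.Finite.image (fun n : ℕ => (n : ℕ∞)) hi).subset ?_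
      rintro _ ⟨_, ⟨q, hq, rfl⟩, rfl⟩
      exact ⟨q i, ⟨q, hq, rfl⟩, by simp [projPC, toPC, hi]⟩
    · refine (Set.finite_singleton ⊤).subset ?_
      rintro _ ⟨_, ⟨q, hq, rfl⟩, rfl⟩
      simp [projPC, hi]
  exact (Set.Finite.pi' hfin).subset fun p hp i => ⟨p, hp, rfl⟩

theorem Egamma_spec {d : ℕ} {A : Set (Act d)} {c : Conf d} {P : Set (Conf d × Conf d)}
    {e : PConf d × Act d × PConf d} (he : e ∈ Egamma A c P) :
    e.1 ∈ Sgamma A c P ∧ e.2.2 ∈ Sgamma A c P ∧ IsPartialTransition A e := by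
  obtain ⟨t, ⟨ρ, hρ, ht⟩, rfl⟩ := he
  refine ⟨⟨t.1, ⟨ρ, hρ, .inr (.inr ⟨t, ht, .inl rfl⟩)⟩, rfl⟩,
    ⟨t.2.2, ⟨ρ, hρ, .inr (.inr ⟨t, ht, .inr rfl⟩)⟩, rfl⟩, (hρ.1.1 t ht).1, fun i => ?_⟩
  by_cases hi : i ∈ Fgamma A c P
  · exact .inr ⟨t.1 i, t.2.2 i, by simp [projPC, toPC, hi], by simp [projPC, toPC, hi],
      (hρ.1.1 t ht).2 i⟩
  · exact .inl ⟨by simp [projPC, hi], by simp [projPC, hi]⟩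

theorem Egamma_finite {d : ℕ} {A : Set (Act d)} (hA : A.Finite) (c : Conf d)
    (P : Set (Conf d × Conf d)) : (Egamma A c P).Finite :=
  ((Sgamma_finite A c P).prod (hA.prod (Sgamma_finite A c P))).subset fun _ he =>
    have h := Egamma_spec he
    ⟨h.1, h.2.2.1, h.2.1⟩

theorem InOmega.edge_mem {d : ℕ} {A : Set (Act d)} {c : Conf d} {P : Set (Conf d × Conf d)}
    {ρ : PreRun d} (hρ : InOmega A c P ρ) : ∀ t ∈ ρ.2.1,
      (projPC (Fgamma A c P) (toPC t.1), t.2.1, projPC (Fgamma A c P) (toPC t.2.2)) ∈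
        Egamma A c P :=
  fun t ht => ⟨t, ⟨ρ, hρ, ht⟩, rfl⟩

/-- The runs of `Ω_γ` start and end in configurations that project to `s_γ`. -/
theorem InOmega.projPC_eq_sgamma {d : ℕ} {A : Set (Act d)} {c : Conf d}
    {P : Set (Conf d × Conf d)} (hper : PeriodicPairs P)
    (hPc : ∀ p ∈ P, Transformer A c p.1 p.2) {ρ : PreRun d} (hρ : InOmega A c P ρ) :
    projPC (Fgamma A c P) (toPC ρ.1) = sgamma A c P ∧
      projPC (Fgamma A c P) (toPC ρ.2.2) = sgamma A c P := by
  obtain ⟨-, p, hp, h₁, h₂⟩ := hρ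
  have hF := Fgamma_subset hper hPc
  rw [h₁, h₂]
  exact ⟨projPC_toPC_add c fun i hi => hF.1 hi p hp, projPC_toPC_add c fun i hi => hF.2 hi p hp⟩

theorem exists_pathIn_sgamma {d : ℕ} {A : Set (Act d)} {c : Conf d}
    {P : Set (Conf d × Conf d)} (hper : PeriodicPairs P)
    (hPc : ∀ p ∈ P, Transformer A c p.1 p.2) {p : PConf d} (hp : p ∈ Sgamma A c P) :
    (∃ σ, PathIn (Egamma A c P) (sgamma A c P) σ p) ∧
      ∃ τ, PathIn (Egamma A c P) p τ (sgamma A c P) := by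
  obtain ⟨q, ⟨ρ, hρ, hq⟩, rfl⟩ := hp
  have h := hρ.1.2.exists_pathIn_of_occursIn (fun q => projPC (Fgamma A c P) (toPC q))
    hρ.edge_mem hq
  simpa only [(hρ.projPC_eq_sgamma hper hPc).1, (hρ.projPC_eq_sgamma hper hPc).2] using h

/-- Let `γ = (c, P)` with `P ⊆ ℕ^d × ℕ^d` periodic and included in `↝_c`.
Then `G_γ = (S_γ, E_γ, s_γ)` is a strongly connected witness graph,
`M_γ = (s_γ^in, G_γ, s_γ^out)` is a marked witness graph, and
`Ω_γ ⊆ Ω_{M_γ}`. -/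
theorem gamma_marked_witness_graph {d : ℕ} (A : Set (Act d)) (hA : A.Finite)
    (c : Conf d) (P : Set (Conf d × Conf d)) (hper : PeriodicPairs P)
    (hPc : ∀ p ∈ P, Transformer A c p.1 p.2) :
    IsMarkedWitnessGraph A (Fgamma A c P) (FinGamma P) (FoutGamma P)
        (Sgamma A c P) (Egamma A c P) (sgamma A c P)
        (sinGamma c P) (soutGamma c P) ∧
      ∀ ρ : PreRun d, InOmega A c P ρ →
        InOmegaM A (FinGamma P) (FoutGamma P) (Egamma A c P) (sgamma A c P)
          (sinGamma c P) (soutGamma c P) ρ := by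
  have hF := Fgamma_subset hper hPc
  have hs : sgamma A c P ∈ Sgamma A c P :=
    ⟨c, by simpa using (add_mem_Qgamma hPc hper.1).1, rfl⟩
  refine ⟨⟨⟨⟨_, hs⟩, Sgamma_finite A c P, ?_, Egamma_finite hA c P, fun e he => Egamma_spec he,
    hs, fun p hp q hq => ?_⟩, hF.1, hF.2, finCoords_projPC_toPC _ c, finCoords_projPC_toPC _ c,
    projPC_projPC_of_subset hF.1 _, projPC_projPC_of_subset hF.2 _⟩, fun ρ hρ => ?_⟩
  · rintro _ ⟨q, -, rfl⟩
    exact finCoords_projPC_toPC _ q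
  · obtain ⟨τ, hτ⟩ := (exists_pathIn_sgamma hper hPc hp).2
    obtain ⟨σ, hσ⟩ := (exists_pathIn_sgamma hper hPc hq).1
    exact ⟨_, hτ.append hσ⟩
  · have hpath := hρ.1.2.pathIn (fun q => projPC (Fgamma A c P) (toPC q)) hρ.edge_mem
    simp only [(hρ.projPC_eq_sgamma hper hPc).1, (hρ.projPC_eq_sgamma hper hPc).2] at hpath
    obtain ⟨hrun, p, hp, h₁, h₂⟩ := hρ
    refine ⟨hrun, hpath, ?_, ?_⟩
    · rw [h₁]
      exact projPC_toPC_add c fun i hi => hi p hp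
    · rw [h₂]
      exact projPC_toPC_add c fun i hi => hi p hp
end
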